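/- arXiv:2410.22329 — 3 statements merged into one kernel-verified Lean document; each statement's English description precedes it below -/
import Mathlib

section
/- For integers 1 ≤ k ≤ n, the following polynomial identity holds in ℤ[x]: Σ_{I ⊆ {1,…,k}, 1 ∈ I} binom(n, ΔI) · x^{|I|−1} = Σ_{D ∈ nc(k−1), 1 ∉ D} E(n,D) · x^{|D|} · (1+x)^{k−1−2|D|}. (Both sides equal the Chow polynomial of the uniform matroid U_{k,n}.) -/
open Finset Polynomial

/-- Differences list: `diffList N prev [m₁,…,m_s] = [m₁ - prev, m₂ - m₁, …, N - m_s]`. -/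
def diffList (N : ℕ) : ℕ → List ℕ → List ℕ
  | prev, [] => [N - prev]
  | prev, m :: ms => (m - prev) :: diffList N m ms

/-- The minima of the maximal blocks of consecutive integers of `I`, listed increasingly. -/
def blockMinima (I : Finset ℕ) : List ℕ :=
  (I.filter fun i => i - 1 ∉ I).sort (· ≤ ·)

/-- The multinomial coefficient `binom(n, ΔI)`:
for `I` with block minima `m₁ < … < m_s` this is
`n! / ((m₁-1)! (m₂-m₁)! ⋯ (m_s-m_{s-1})! (n-m_s+1)!)`, and `1` for `I = ∅`. -/
def binomDelta (n : ℕ) (I : Finset ℕ) : ℕ :=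
  n.factorial / ((diffList (n + 1) 1 (blockMinima I)).map Nat.factorial).prod

/-- One-line notation: `oneline n w i = w(i)` for `i ∈ {1,…,n}`, with values in `{1,…,n}`. -/
def oneline (n : ℕ) (w : Equiv.Perm (Fin n)) (i : ℕ) : ℕ :=
  if h : i - 1 < n then (w ⟨i - 1, h⟩ : ℕ) + 1 else 0

/-- The descent set `Des(w) ⊆ {1,…,n-1}` of a permutation `w` of `{1,…,n}`:
positions `i` with `w(i) > w(i+1)`. -/
def descSet (n : ℕ) (w : Equiv.Perm (Fin n)) : Finset ℕ :=
  (Finset.Ico 1 n).filter fun i => oneline n w (i + 1) < oneline n w i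

/-- `E(n, D)`: the number of permutations of `{1,…,n}` with descent set exactly `D`. -/
def eulerianCount (n : ℕ) (D : Finset ℕ) : ℕ :=
  (Finset.univ.filter fun w : Equiv.Perm (Fin n) => descSet n w = D).card

theorem sort_comp_inv_eq_iff {n : ℕ} {b : Fin n → ℕ} (hb : Monotone b)
    (v w : Equiv.Perm (Fin n)) :
    Tuple.sort (b ∘ ⇑v⁻¹) = w ↔
      b ∘ ⇑(v⁻¹ * w) = b ∧ ∀ i j, i < j → b i = b j → w i < w j := by
  rw [eq_comm, Tuple.eq_sort_iff]
  have key : Monotone ((b ∘ ⇑v⁻¹) ∘ ⇑w) ↔ b ∘ ⇑(v⁻¹ * w) = b := by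
    rw [Function.comp_assoc, ← Equiv.Perm.coe_mul]
    refine ⟨fun h => ?_, fun h => h.symm ▸ hb⟩
    exact Tuple.unique_monotone (τ := 1) h hb
  rw [key]
  refine and_congr_right fun h => ?_
  have h' : ∀ i, (b ∘ ⇑v⁻¹) (w i) = b i := fun i => congrFun h i
  simp only [h']

/-- The permutations increasing on the fibres of a monotone `b` represent the cosets of the
stabilizer of `b`. -/
theorem card_increasing_on_fibers_mul_card_stabilizer {n : ℕ} {b : Fin n → ℕ}
    (hb : Monotone b) :
    #{w : Equiv.Perm (Fin n) | ∀ i j, i < j → b i = b j → w i < w j}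
      * Fintype.card {g : Equiv.Perm (Fin n) // b ∘ g = b} = n.factorial := by
  have hn : #(univ : Finset (Equiv.Perm (Fin n))) = n.factorial := by
    rw [Finset.card_univ, Fintype.card_perm, Fintype.card_fin]
  rw [← hn]
  refine Eq.symm ((Finset.card_eq_sum_card_fiberwise
    (f := fun v : Equiv.Perm (Fin n) => Tuple.sort (b ∘ ⇑v⁻¹))
    (t := {w : Equiv.Perm (Fin n) | ∀ i j, i < j → b i = b j → w i < w j}) ?_).trans
    (Finset.sum_const_nat fun w hw => ?_))
  rotate_left
  · rw [Fintype.card_subtype]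
    refine Finset.card_nbij' (fun v => v⁻¹ * w) (fun g => w * g⁻¹) ?_ ?_ ?_ ?_
    · intro v hv
      simp only [coe_filter, mem_univ, true_and, Set.mem_ofPred_eq] at hv ⊢
      exact ((sort_comp_inv_eq_iff hb v w).1 hv).1
    · intro g hg
      simp only [coe_filter, mem_univ, true_and, Set.mem_ofPred_eq] at hg hw ⊢
      refine (sort_comp_inv_eq_iff hb _ w).2 ⟨?_, (mem_filter.1 hw).2⟩
      simpa [mul_assoc] using hg
    · intro v _
      simp
    · intro g _
      simp
  · intro v _
    simp only [coe_filter, mem_univ, true_and, Set.mem_ofPred_eq]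
    exact ((sort_comp_inv_eq_iff hb v _).1 rfl).2

/-- The factorials of the gaps of a sorted list, as factorials of the sizes of the level sets of
the counting function `i ↦ #{m ∈ L | m ≤ i}`. -/
theorem prod_factorial_diffList (N : ℕ) (L : List ℕ) (prev : ℕ)
    (hL : (prev :: L).Pairwise (· ≤ ·)) (hN : ∀ m ∈ L, m ≤ N) :
    ((diffList N prev L).map Nat.factorial).prod =
      ∏ j ∈ range (L.length + 1),
        (#{i ∈ Ico prev N | L.countP (· ≤ i) = j}).factorial := by
  induction L generalizing prev with
  | nil => simp [diffList]
  | cons m ms ih =>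
    rw [List.pairwise_cons] at hL
    have hpm : prev ≤ m := hL.1 m (by simp)
    have hmN : m ≤ N := hN m (by simp)
    have hms : ∀ x ∈ ms, m ≤ x := (List.pairwise_cons.1 hL.2).1
    have hzero : ∀ i < m, ms.countP (· ≤ i) = 0 := by
      intro i hi
      rw [List.countP_eq_zero]
      intro x hx
      have := hms x hx
      simp
      omega
    rw [List.length_cons, Finset.prod_range_succ', diffList, List.map_cons, List.prod_cons,
      ih m hL.2 (fun x hx => hN x (by simp [hx])), mul_comm]
    congr 1
    · refine Finset.prod_congr rfl fun j _ => ?_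
      congr 2
      ext i
      simp only [mem_filter, mem_Ico]
      simp only [List.countP_cons, decide_eq_true_eq]
      by_cases h : m ≤ i
      · rw [if_pos h]
        omega
      · have := hzero i (by omega)
        rw [if_neg h]
        omega
    · congr 1
      rw [← Nat.card_Ico]
      congr 1
      ext i
      simp only [mem_filter, mem_Ico]
      simp only [List.countP_cons, decide_eq_true_eq]
      by_cases h : m ≤ i
      · rw [if_pos h]
        omega
      · have := hzero i (by omega)
        rw [if_neg h]
        omega

theorem mem_blockMinima {I : Finset ℕ} {m : ℕ} : m ∈ blockMinima I ↔ m ∈ I ∧ m - 1 ∉ I := by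
  simp [blockMinima]

/-- The number of block minima of `I` among the positions up to that of `a : Fin n`. -/
def blockIndex (n : ℕ) (I : Finset ℕ) (a : Fin n) : ℕ :=
  (blockMinima I).countP (· ≤ (a : ℕ) + 1)

theorem monotone_blockIndex (n : ℕ) (I : Finset ℕ) : Monotone (blockIndex n I) := by
  intro a a' h
  refine List.countP_mono_left fun x _ hx => ?_
  have h' : (a : ℕ) ≤ a' := h
  simp only [decide_eq_true_eq] at hx ⊢
  omega

theorem prod_factorial_diffList_blockMinima {n : ℕ} {I : Finset ℕ} (hI : I ⊆ Icc 1 n) :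
    ((diffList (n + 1) 1 (blockMinima I)).map Nat.factorial).prod =
      Fintype.card {g : Equiv.Perm (Fin n) // blockIndex n I ∘ g = blockIndex n I} := by
  have hmem : ∀ m ∈ blockMinima I, 1 ≤ m ∧ m ≤ n := fun m hm =>
    mem_Icc.1 (hI (mem_blockMinima.1 hm).1)
  rw [DomMulAct.stabilizer_card', prod_factorial_diffList]
  · have hcard : ∀ j, #{i ∈ Ico 1 (n + 1) | (blockMinima I).countP (· ≤ i) = j} =
        Fintype.card {a : Fin n // blockIndex n I a = j} := by
      intro j
      rw [Fintype.card_subtype]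
      symm
      refine Finset.card_bij (fun a _ => (a : ℕ) + 1) ?_ ?_ ?_
      · intro a ha
        have := a.2
        simp only [mem_filter, mem_univ, true_and, mem_Ico] at ha ⊢
        exact ⟨by omega, ha⟩
      · intro a _ a' _ h
        exact Fin.ext (by omega)
      · intro i hi
        simp only [mem_filter, mem_Ico] at hi
        have hi1 : i - 1 + 1 = i := by omega
        refine ⟨⟨i - 1, by omega⟩, ?_, hi1⟩
        rw [mem_filter]
        refine ⟨mem_univ _, ?_⟩
        simp only [blockIndex, hi1]
        exact hi.2
    simp only [hcard]
    symm
    refine Finset.prod_subset ?_ ?_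
    · intro j hj
      obtain ⟨a, -, rfl⟩ := mem_image.1 hj
      exact mem_range.2 (Nat.lt_succ_of_le List.countP_le_length)
    · intro j _ hj
      rw [Fintype.card_eq_zero_iff.2, Nat.factorial_zero]
      exact ⟨fun a => hj (mem_image.2 ⟨a.1, mem_univ _, a.2⟩)⟩
  · rw [List.pairwise_cons]
    exact ⟨fun m hm => (hmem m hm).1, Finset.pairwise_sort _ _⟩
  · exact fun m hm => by have := hmem m hm; omega

theorem mem_descSet {n : ℕ} {w : Equiv.Perm (Fin n)} {i : ℕ} :
    i ∈ descSet n w ↔ ∃ h : 1 ≤ i ∧ i < n, w ⟨i, h.2⟩ < w ⟨i - 1, by omega⟩ := by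
  rw [descSet, mem_filter, mem_Ico]
  simp only [oneline]
  constructor
  · rintro ⟨h, hlt⟩
    refine ⟨h, ?_⟩
    rw [dif_pos (by omega : i + 1 - 1 < n), dif_pos (by omega : i - 1 < n)] at hlt
    simpa only [Nat.add_sub_cancel, Fin.lt_def, Nat.add_lt_add_iff_right] using hlt
  · rintro ⟨h, hlt⟩
    refine ⟨h, ?_⟩
    rw [dif_pos (by omega : i + 1 - 1 < n), dif_pos (by omega : i - 1 < n)]
    simpa only [Nat.add_sub_cancel, Fin.lt_def, Nat.add_lt_add_iff_right] using hlt

theorem blockIndex_succ_eq_iff {n : ℕ} {I : Finset ℕ} {i : ℕ} (hi : 1 ≤ i) (hin : i < n) :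
    blockIndex n I ⟨i - 1, by omega⟩ = blockIndex n I ⟨i, hin⟩ ↔ ¬(i + 1 ∈ I ∧ i ∉ I) := by
  have hmem : i + 1 ∈ blockMinima I ↔ i + 1 ∈ I ∧ i ∉ I := by simp [mem_blockMinima]
  have h1 : i - 1 + 1 = i := by omega
  rw [← hmem]
  simp only [blockIndex, h1]
  generalize blockMinima I = L
  induction L with
  | nil => simp
  | cons m ms ih =>
    have hle : ms.countP (· ≤ i) ≤ ms.countP (· ≤ i + 1) := by
      refine List.countP_mono_left fun x _ hx => ?_
      simp only [decide_eq_true_eq] at hx ⊢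
      omega
    simp only [List.countP_cons, decide_eq_true_eq, List.mem_cons, not_or]
    by_cases hm : i + 1 ∈ ms
    · have := mt ih.1 (not_not.2 hm)
      simp only [hm, not_true, and_false, iff_false]
      split_ifs <;> omega
    · have := ih.2 hm
      simp only [hm, not_false_eq_true, and_true]
      split_ifs <;> omega

theorem increasing_on_blocks_iff {n : ℕ} {I : Finset ℕ} {w : Equiv.Perm (Fin n)} :
    (∀ a a', a < a' → blockIndex n I a = blockIndex n I a' → w a < w a') ↔
      ∀ i ∈ descSet n w, i + 1 ∈ I ∧ i ∉ I := by
  constructor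
  · intro h i hi
    obtain ⟨⟨h1, hin⟩, hlt⟩ := mem_descSet.1 hi
    by_contra hI
    refine absurd (h ⟨i - 1, by omega⟩ ⟨i, hin⟩ ?_ ((blockIndex_succ_eq_iff h1 hin).2 hI)) hlt.not_gt
    rw [Fin.lt_def]
    show i - 1 < i
    omega
  · intro h
    have key : ∀ d a : ℕ, ∀ hd : a + 1 + d < n,
        blockIndex n I ⟨a, by omega⟩ = blockIndex n I ⟨a + 1 + d, hd⟩ →
          w ⟨a, by omega⟩ < w ⟨a + 1 + d, hd⟩ := by
      have step : ∀ a : ℕ, ∀ ha : a + 1 < n,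
          blockIndex n I ⟨a, by omega⟩ = blockIndex n I ⟨a + 1, ha⟩ →
            w ⟨a, by omega⟩ < w ⟨a + 1, ha⟩ := by
        intro a ha hb
        have hnot : a + 1 ∉ descSet n w := fun hmem =>
          (blockIndex_succ_eq_iff (I := I) (by omega : 1 ≤ a + 1) ha).1 hb (h _ hmem)
        rw [mem_descSet] at hnot
        have hle : w ⟨a, by omega⟩ ≤ w ⟨a + 1, ha⟩ :=
          not_lt.1 fun hlt => hnot ⟨⟨by omega, ha⟩, hlt⟩
        refine lt_of_le_of_ne hle fun heq => ?_
        have := congrArg Fin.val (w.injective heq)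
        simp at this
      intro d
      induction d with
      | zero => exact step
      | succ d ih =>
        intro a hd hb
        have hle1 : blockIndex n I ⟨a, by omega⟩ ≤ blockIndex n I ⟨a + 1 + d, by omega⟩ :=
          monotone_blockIndex n I (by rw [Fin.le_def]; show a ≤ a + 1 + d; omega)
        have hle2 : blockIndex n I ⟨a + 1 + d, by omega⟩ ≤ blockIndex n I ⟨a + 1 + (d + 1), hd⟩ :=
          monotone_blockIndex n I (by rw [Fin.le_def]; show a + 1 + d ≤ a + 1 + (d + 1); omega)
        exact (ih a (by omega) (by omega)).trans (step (a + 1 + d) hd (le_antisymm hle2 (hb ▸ hle1)))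
    intro a a' haa' hb
    have hlt : (a : ℕ) < a' := haa'
    obtain ⟨d, hd⟩ := Nat.exists_eq_add_of_lt hlt
    have ha' : a' = ⟨a + 1 + d, by have := a'.2; omega⟩ := Fin.ext (by simp; omega)
    rw [ha'] at hb ⊢
    exact key d a _ hb

/-- `binom(n, ΔI)` counts the permutations all of whose descents are the last positions before
a block of `I`. -/
theorem binomDelta_eq_card {n : ℕ} {I : Finset ℕ} (hI : I ⊆ Icc 1 n) :
    binomDelta n I =
      #{w : Equiv.Perm (Fin n) | ∀ i ∈ descSet n w, i + 1 ∈ I ∧ i ∉ I} := by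
  have hmul := card_increasing_on_fibers_mul_card_stabilizer (monotone_blockIndex n I)
  simp only [increasing_on_blocks_iff] at hmul
  rw [binomDelta, prod_factorial_diffList_blockMinima hI, ← hmul]
  exact Nat.mul_div_cancel _ (Fintype.card_pos_iff.2 ⟨⟨1, rfl⟩⟩)

theorem binomDelta_eq_sum_eulerianCount {n k : ℕ} (hkn : k ≤ n) {I : Finset ℕ}
    (hI : I ⊆ Icc 1 k) (h1 : 1 ∈ I) :
    binomDelta n I =
      ∑ D ∈ (Icc 1 (k - 1)).powerset.filter (fun D => (∀ i ∈ D, i + 1 ∉ D) ∧ 1 ∉ D),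
        if ∀ i ∈ D, i + 1 ∈ I ∧ i ∉ I then eulerianCount n D else 0 := by
  rw [binomDelta_eq_card (hI.trans (Icc_subset_Icc_right hkn)),
    Finset.card_eq_sum_card_fiberwise (f := descSet n)
      (t := (Icc 1 (k - 1)).powerset.filter (fun D => (∀ i ∈ D, i + 1 ∉ D) ∧ 1 ∉ D))]
  · refine Finset.sum_congr rfl fun D _ => ?_
    rw [filter_filter]
    split_ifs with h
    · rw [eulerianCount]
      congr 1
      ext w
      simp only [mem_filter, mem_univ, true_and, and_iff_right_iff_imp]
      rintro rfl
      exact h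
    · rw [Finset.card_eq_zero, filter_eq_empty_iff]
      rintro w - ⟨hw, rfl⟩
      exact h hw
  · intro w hw
    simp only [coe_filter, mem_univ, true_and, Set.mem_ofPred_eq, mem_powerset] at hw ⊢
    refine ⟨fun i hi => ?_, fun i hi hi' => (hw _ hi').2 (hw _ hi).1, fun h => (hw 1 h).2 h1⟩
    have := (mem_Icc.1 (hI (hw i hi).1)).2
    have := (mem_descSet.1 hi).1.1
    rw [mem_Icc]
    omega

theorem sum_X_pow_card_sub_one {k : ℕ} (hk : 1 ≤ k) {D : Finset ℕ} (hD : D ⊆ Icc 1 (k - 1))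
    (hnc : ∀ i ∈ D, i + 1 ∉ D) (h1 : 1 ∉ D) :
    ∑ I ∈ (Icc 1 k).powerset.filter (fun I => 1 ∈ I),
        (if ∀ i ∈ D, i + 1 ∈ I ∧ i ∉ I then (X : ℤ[X]) ^ (#I - 1) else 0) =
      X ^ #D * (1 + X) ^ (k - 1 - 2 * #D) := by
  have hinj : Function.Injective (fun i : ℕ => i + 1) := fun _ _ h => Nat.succ.inj h
  set D' := D.image (fun i : ℕ => i + 1) with hD'
  have hmemD' : ∀ i, i ∈ D' ↔ ∃ j ∈ D, j + 1 = i := fun i => mem_image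
  have hcardD' : #D' = #D := card_image_of_injective _ hinj
  have hdisj : Disjoint D D' := by
    rw [Finset.disjoint_left]
    intro i hi hi'
    obtain ⟨j, hj, rfl⟩ := (hmemD' i).1 hi'
    exact hnc j hj hi
  have hDD' : D ∪ D' ⊆ Icc 2 k := by
    intro i hi
    rcases mem_union.1 hi with h | h
    · have := mem_Icc.1 (hD h)
      have : i ≠ 1 := fun h' => h1 (h' ▸ h)
      rw [mem_Icc]
      omega
    · obtain ⟨j, hj, rfl⟩ := (hmemD' i).1 h
      have := mem_Icc.1 (hD hj)
      rw [mem_Icc]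
      omega
  set F := Icc 2 k \ (D ∪ D') with hF
  have hcardF : #F = k - 1 - 2 * #D := by
    rw [hF, card_sdiff_of_subset hDD', card_union_of_disjoint hdisj, hcardD', Nat.card_Icc]
    omega
  have hbinom := Finset.sum_pow_mul_eq_add_pow (X : ℤ[X]) 1 F
  simp only [one_pow, mul_one] at hbinom
  rw [← Finset.sum_filter, filter_filter, ← hcardF, add_comm 1 X, ← hbinom, Finset.mul_sum]
  have hone : 1 ∉ D' := fun h => by
    have := mem_Icc.1 (hDD' (mem_union_right _ h))
    omega
  have hdec : ∀ I ∈ (Icc 1 k).powerset.filter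
      (fun I => 1 ∈ I ∧ ∀ i ∈ D, i + 1 ∈ I ∧ i ∉ I), insert 1 (D' ∪ I ∩ F) = I := by
    intro I hI
    simp only [mem_filter, mem_powerset] at hI
    obtain ⟨hIk, hI1, hID⟩ := hI
    ext i
    simp only [mem_insert, mem_union, mem_inter, hF, mem_sdiff, mem_Icc, not_or]
    constructor
    · rintro (rfl | h | h)
      · exact hI1
      · obtain ⟨j, hj, rfl⟩ := (hmemD' i).1 h
        exact (hID j hj).1
      · exact h.1
    · intro hi
      have := mem_Icc.1 (hIk hi)
      by_cases hi1 : i = 1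
      · exact Or.inl hi1
      by_cases hiD' : i ∈ D'
      · exact Or.inr (Or.inl hiD')
      · exact Or.inr (Or.inr ⟨hi, ⟨by omega, by omega⟩, fun h => (hID i h).2 hi, hiD'⟩)
  refine Finset.sum_nbij' (fun I => I ∩ F) (fun J => insert 1 (D' ∪ J)) ?_ ?_ ?_ ?_ ?_
  · intro I _
    exact mem_powerset.2 inter_subset_right
  · intro J hJ
    have hJ := mem_powerset.1 hJ
    simp only [mem_filter, mem_powerset]
    refine ⟨?_, mem_insert_self _ _, fun i hi => ⟨?_, ?_⟩⟩
    · intro i hi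
      rcases mem_insert.1 hi with rfl | hi
      · exact mem_Icc.2 ⟨le_rfl, hk⟩
      · have : i ∈ Icc 2 k := by
          rcases mem_union.1 hi with h | h
          · exact hDD' (mem_union_right _ h)
          · exact (mem_sdiff.1 (hJ h)).1
        rw [mem_Icc] at this ⊢
        omega
    · exact mem_insert_of_mem (mem_union_left _ ((hmemD' _).2 ⟨i, hi, rfl⟩))
    · intro h
      rcases mem_insert.1 h with rfl | h
      · exact h1 hi
      · rcases mem_union.1 h with h | h
        · exact Finset.disjoint_left.1 hdisj hi h
        · exact (mem_sdiff.1 (hJ h)).2 (mem_union_left _ hi)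
  · exact hdec
  · intro J hJ
    have hJ := mem_powerset.1 hJ
    ext i
    simp only [mem_inter, mem_insert, mem_union]
    constructor
    · rintro ⟨rfl | h | h, hi⟩
      · have := mem_Icc.1 (mem_sdiff.1 hi).1
        omega
      · exact absurd (mem_union_right _ h) (mem_sdiff.1 hi).2
      · exact h
    · exact fun h => ⟨Or.inr (Or.inr h), hJ h⟩
  · intro I hI
    have hdisj' : Disjoint D' (I ∩ F) := by
      rw [Finset.disjoint_left]
      intro i hi hi'
      exact (mem_sdiff.1 (mem_inter.1 hi').2).2 (mem_union_right _ hi)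
    have hnotMem : 1 ∉ D' ∪ I ∩ F := by
      rw [mem_union, not_or]
      refine ⟨hone, fun h => ?_⟩
      have := mem_Icc.1 (mem_sdiff.1 (mem_inter.1 h).2).1
      omega
    have hcard := congrArg Finset.card (hdec I hI)
    rw [card_insert_of_notMem hnotMem, card_union_of_disjoint hdisj', hcardD'] at hcard
    rw [← pow_add, ← hcard, Nat.add_sub_cancel]

/-- For `1 ≤ k ≤ n`, in `ℤ[x]`:
`Σ_{I ⊆ {1,…,k}, 1 ∈ I} binom(n, ΔI) x^{|I|-1}
  = Σ_{D ∈ nc(k-1), 1 ∉ D} E(n,D) x^{|D|} (1+x)^{k-1-2|D|}`. -/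
theorem chow_uniform_monomial_eq_gamma_eulerian (n k : ℕ) (hk : 1 ≤ k) (hkn : k ≤ n) :
    ∑ I ∈ (Finset.Icc 1 k).powerset.filter (fun I => 1 ∈ I),
      (binomDelta n I : Polynomial ℤ) * X ^ (I.card - 1)
    = ∑ D ∈ (Finset.Icc 1 (k - 1)).powerset.filter
        (fun D => (∀ i ∈ D, i + 1 ∉ D) ∧ 1 ∉ D),
      (eulerianCount n D : Polynomial ℤ) * X ^ D.card
        * (1 + X) ^ (k - 1 - 2 * D.card) := by
  have hterm : ∀ I ∈ (Icc 1 k).powerset.filter (fun I => 1 ∈ I),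
      (binomDelta n I : Polynomial ℤ) * X ^ (I.card - 1) =
        ∑ D ∈ (Icc 1 (k - 1)).powerset.filter (fun D => (∀ i ∈ D, i + 1 ∉ D) ∧ 1 ∉ D),
          (eulerianCount n D : Polynomial ℤ) *
            (if ∀ i ∈ D, i + 1 ∈ I ∧ i ∉ I then X ^ (#I - 1) else 0) := by
    intro I hI
    obtain ⟨hI, h1⟩ := mem_filter.1 hI
    rw [binomDelta_eq_sum_eulerianCount hkn (mem_powerset.1 hI) h1, Nat.cast_sum,
      Finset.sum_mul]
    refine Finset.sum_congr rfl fun D _ => ?_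
    split_ifs <;> simp
  rw [Finset.sum_congr rfl hterm, Finset.sum_comm]
  refine Finset.sum_congr rfl fun D hD => ?_
  obtain ⟨hD, hnc, h1⟩ := mem_filter.1 hD
  rw [← Finset.mul_sum, sum_X_pow_card_sub_one hk (mem_powerset.1 hD) hnc h1, mul_assoc]
end

section
/- For integers 1 ≤ k ≤ n, the following polynomial identity holds in ℤ[x]: Σ_{I ⊆ {1,…,k}} binom(n, ΔI) · x^{|I|} = Σ_{σ ∈ S_k, Des(σ) ∈ nc(k−1)} binom(n−σ(k), k−σ(k)) · x^{des(σ)} · (1+x)^{k−2·des(σ)}. (Both sides equal the augmented Chow polynomial of the uniform matroid U_{k,n}.) -/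
open Finset Polynomial

/-- The permutation of `Fin (k + 1)` whose last value is `p` and whose other values are in the same
relative order as those of `τ`. -/
def Equiv.Perm.extendLast {k : ℕ} (p : Fin (k + 1)) (τ : Equiv.Perm (Fin k)) :
    Equiv.Perm (Fin (k + 1)) :=
  ((finSuccEquiv' (Fin.last k)).trans (Equiv.optionCongr τ)).trans (finSuccEquiv' p).symm

namespace Equiv.Perm

@[simp]
lemma extendLast_last {k : ℕ} (p : Fin (k + 1)) (τ : Equiv.Perm (Fin k)) :
    extendLast p τ (Fin.last k) = p := by
  simp [extendLast]

@[simp]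
lemma extendLast_castSucc {k : ℕ} (p : Fin (k + 1)) (τ : Equiv.Perm (Fin k)) (i : Fin k) :
    extendLast p τ i.castSucc = p.succAbove (τ i) := by
  rw [← Fin.succAbove_last_apply i]
  simp [extendLast, -Fin.succAbove_last]

lemma extendLast_bijective (k : ℕ) :
    Function.Bijective fun x : Fin (k + 1) × Equiv.Perm (Fin k) => extendLast x.1 x.2 := by
  rw [Fintype.bijective_iff_injective_and_card]
  refine ⟨?_, by simp [Fintype.card_perm, Nat.factorial_succ]⟩
  rintro ⟨p, τ⟩ ⟨q, ρ⟩ h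
  have hp : p = q := by simpa using Equiv.congr_fun h (Fin.last k)
  subst hp
  refine Prod.ext rfl (Equiv.ext fun i => ?_)
  simpa using Equiv.congr_fun h i.castSucc

end Equiv.Perm

open Equiv.Perm

lemma sum_perm_succ {M : Type*} [AddCommMonoid M] (k : ℕ) (f : Equiv.Perm (Fin (k + 1)) → M) :
    ∑ σ, f σ = ∑ τ : Equiv.Perm (Fin k), ∑ p, f (extendLast p τ) := by
  rw [← (extendLast_bijective k).sum_comp, Fintype.sum_prod_type_right]

lemma oneline_le (k : ℕ) (σ : Equiv.Perm (Fin k)) (i : ℕ) : oneline k σ i ≤ k := by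
  unfold oneline
  split_ifs
  · exact (σ _).isLt
  · exact Nat.zero_le k

lemma oneline_extendLast_last {k : ℕ} (p : Fin (k + 1)) (τ : Equiv.Perm (Fin k)) :
    oneline (k + 1) (extendLast p τ) (k + 1) = p + 1 := by
  have : (⟨k, k.lt_succ_self⟩ : Fin (k + 1)) = Fin.last k := rfl
  simp [oneline, this]

lemma oneline_extendLast {k : ℕ} (p : Fin (k + 1)) (τ : Equiv.Perm (Fin k)) {i : ℕ}
    (hi : 1 ≤ i) (hik : i ≤ k) :
    oneline (k + 1) (extendLast p τ) i =
      if oneline k τ i ≤ p then oneline k τ i else oneline k τ i + 1 := by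
  have h : i - 1 < k := by omega
  have h' : (⟨i - 1, h.trans k.lt_succ_self⟩ : Fin (k + 1)) = Fin.castSucc ⟨i - 1, h⟩ := rfl
  simp only [oneline, h, h.trans k.lt_succ_self, dif_pos, h', extendLast_castSucc, Fin.succAbove,
    Fin.lt_def, Fin.val_castSucc, Nat.add_one_le_iff]
  split_ifs <;> simp

lemma descSet_subset_Ico (n : ℕ) (w : Equiv.Perm (Fin n)) : descSet n w ⊆ Ico 1 n :=
  filter_subset _ _

lemma descSet_extendLast {k : ℕ} (p : Fin (k + 1)) (τ : Equiv.Perm (Fin k)) :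
    descSet (k + 1) (extendLast p τ) =
      if p < oneline k τ k then insert k (descSet k τ) else descSet k τ := by
  have key (i : ℕ) : i ∈ descSet (k + 1) (extendLast p τ) ↔
      i ∈ descSet k τ ∨ (i = k ∧ p < oneline k τ k) := by
    simp only [descSet, mem_filter, mem_Ico]
    rcases lt_trichotomy i k with hi | rfl | hi
    · by_cases h1 : 1 ≤ i
      · rw [oneline_extendLast p τ h1 hi.le, oneline_extendLast p τ (Nat.le_add_left 1 i) hi]
        split_ifs <;> omega
      · omega
    · by_cases h1 : 1 ≤ i
      · rw [oneline_extendLast p τ h1 le_rfl, oneline_extendLast_last]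
        split_ifs <;> omega
      · have := oneline_le i τ i
        omega
    · omega
  ext i
  rw [key]
  split_ifs with h <;> simp [h, or_comm]

lemma sum_choose_of_le {n k t : ℕ} (hkn : k < n) (ht : t ≤ k) :
    ∑ p : Fin (k + 1), (if (p : ℕ) < t then 0 else (n - (p + 1)).choose (k + 1 - (p + 1))) =
      (n - t).choose (k - t) := by
  obtain ⟨r, rfl⟩ := Nat.exists_eq_add_of_le hkn
  obtain ⟨m, rfl⟩ := Nat.exists_eq_add_of_le ht
  rw [Fin.sum_univ_eq_sum_range
    (fun p => if p < t then 0 else ((t + m).succ + r - (p + 1)).choose (t + m + 1 - (p + 1))),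
    add_assoc t m 1, Finset.sum_range_add, Finset.sum_eq_zero (by simp +contextual), zero_add,
    ← Finset.sum_range_reflect]
  have e : (t + m).succ + r - t = m + r + 1 := by omega
  rw [e, Nat.add_sub_cancel_left, Nat.choose_symm_of_eq_add (b := r + 1) (by omega),
    ← Nat.sum_range_add_choose m r]
  refine Finset.sum_congr rfl fun j hj => ?_
  rw [mem_range] at hj
  rw [if_neg (by omega), Nat.choose_symm_of_eq_add (b := r) (by omega)]
  congr 1
  omega

/-- Permutations of `[n]` without descents from position `k` on, grouped by the pattern of their
first `k` entries. -/
lemma sum_descSet_eq_sum_choose {R : Type*} [CommSemiring R] {n k : ℕ} (hk : 1 ≤ k) (hkn : k ≤ n)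
    (F : Finset ℕ → R) (hF : ∀ D, ∀ i ∈ D, k ≤ i → F D = 0) :
    ∑ w : Equiv.Perm (Fin n), F (descSet n w) =
      ∑ σ : Equiv.Perm (Fin k),
        ((n - oneline k σ k).choose (k - oneline k σ k) : R) * F (descSet k σ) := by
  induction hkn using Nat.decreasingInduction with
  | self => simp
  | of_succ k hkn ih =>
    rw [ih (by omega) fun D i hi hki => hF D i hi (by omega), sum_perm_succ]
    refine Finset.sum_congr rfl fun τ _ => ?_
    rw [← sum_choose_of_le hkn (oneline_le k τ k), Nat.cast_sum, Finset.sum_mul]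
    refine Finset.sum_congr rfl fun p _ => ?_
    rw [oneline_extendLast_last, descSet_extendLast]
    split_ifs
    · rw [hF _ k (mem_insert_self _ _) le_rfl]; simp
    · rfl

/-- The number of permutations of `[n]` all of whose descents `i` satisfy `i + 1 ∈ l`. -/
def descentBoundedCount (n : ℕ) (l : List ℕ) : ℕ :=
  ∑ w : Equiv.Perm (Fin n), if ∀ i ∈ descSet n w, i + 1 ∈ l then 1 else 0

lemma descentBoundedCount_nil (n : ℕ) : descentBoundedCount n [] = 1 := by
  rcases n.eq_zero_or_pos with rfl | hn
  · simp [descentBoundedCount, descSet]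
  · rw [descentBoundedCount, sum_descSet_eq_sum_choose le_rfl hn
      (fun D => if ∀ i ∈ D, i + 1 ∈ ([] : List ℕ) then 1 else 0)
      (fun D i hi _ => if_neg fun h => by simpa using h i hi)]
    simp [descSet, oneline]

lemma descentBoundedCount_append {n m : ℕ} (hmn : m < n) {l : List ℕ} (hl : ∀ x ∈ l, x ≤ m) :
    descentBoundedCount n (l ++ [m + 1]) = n.choose m * descentBoundedCount m l := by
  rw [descentBoundedCount, sum_descSet_eq_sum_choose (by omega) hmn
      (fun D => if ∀ i ∈ D, i + 1 ∈ l ++ [m + 1] then 1 else 0)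
      (fun D i hi hmi => if_neg fun h => ?_), sum_perm_succ, descentBoundedCount, Finset.mul_sum]
  · refine Finset.sum_congr rfl fun τ _ => ?_
    have hD (p : Fin (m + 1)) :
        (∀ i ∈ descSet (m + 1) (extendLast p τ), i + 1 ∈ l ++ [m + 1]) ↔
          ∀ i ∈ descSet m τ, i + 1 ∈ l := by
      have h (i : ℕ) (hi : i ∈ descSet m τ) : i + 1 ∈ l ++ [m + 1] ↔ i + 1 ∈ l := by
        have := mem_Ico.1 (descSet_subset_Ico m τ hi)
        simp; omega
      rw [descSet_extendLast]
      split_ifs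
      · simp only [forall_mem_insert]
        simp +contextual [h]
      · exact forall₂_congr h
    simp only [hD, oneline_extendLast_last, ← Finset.sum_mul]
    congr 1
    simpa using sum_choose_of_le hmn (Nat.zero_le m)
  · have := h i hi
    simp only [List.mem_append, List.mem_singleton] at this
    rcases this with h | h
    · have := hl _ h
      omega
    · omega

lemma diffList_append_singleton (N m prev : ℕ) (l : List ℕ) :
    diffList N prev (l ++ [m]) = diffList m prev l ++ [N - m] := by
  induction l generalizing prev with
  | nil => rfl
  | cons a l ih => simp [diffList, ih]

lemma descentBoundedCount_mul_prod {n : ℕ} {l : List ℕ} (hl : l.Pairwise (· < ·))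
    (h : ∀ x ∈ l, 1 ≤ x ∧ x ≤ n) :
    descentBoundedCount n l * ((diffList (n + 1) 1 l).map Nat.factorial).prod = n.factorial := by
  induction l using List.reverseRecOn generalizing n with
  | nil => simp [descentBoundedCount_nil, diffList]
  | append_singleton l a ih =>
    obtain ⟨h1, h2⟩ := h a (by simp)
    obtain ⟨m, rfl⟩ := Nat.exists_eq_add_of_le' h1
    rw [List.pairwise_append] at hl
    have hlm (x : ℕ) (hx : x ∈ l) : x ≤ m := Nat.lt_succ_iff.1 (hl.2.2 x hx (m + 1) (by simp))
    have := ih hl.1 fun x hx => ⟨(h x (by simp [hx])).1, hlm x hx⟩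
    rw [descentBoundedCount_append h2 hlm, diffList_append_singleton, List.map_append,
      List.prod_append, ← Nat.choose_mul_factorial_mul_factorial (Nat.le_of_succ_le h2), ← this]
    simp
    ring

lemma binomDelta_eq_sum {n : ℕ} {I : Finset ℕ} (hI : I ⊆ Icc 1 n) :
    binomDelta n I = ∑ w : Equiv.Perm (Fin n),
      if ∀ i ∈ descSet n w, i + 1 ∈ I ∧ i ∉ I then 1 else 0 := by
  have h := descentBoundedCount_mul_prod (n := n) (l := blockMinima I)
    (Finset.sortedLT_sort _).pairwise (fun x hx => by
      simp only [blockMinima, mem_sort, mem_filter] at hx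
      exact mem_Icc.1 (hI hx.1))
  rw [binomDelta, ← h, Nat.mul_div_cancel]
  · simp [descentBoundedCount, blockMinima]
  · exact Nat.pos_of_ne_zero fun h0 => n.factorial_ne_zero (by rw [← h, h0, mul_zero])

/-- Summing over the `I ⊆ [k]` in which every `i + 1` with `i ∈ D` is the minimum of a block. -/
lemma sum_powerset_filter_blockMinima {R : Type*} [CommSemiring R] (x : R) {k : ℕ} {D : Finset ℕ}
    (hD : D ⊆ Ico 1 k) :
    ∑ I ∈ (Icc 1 k).powerset with ∀ i ∈ D, i + 1 ∈ I ∧ i ∉ I, x ^ #I =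
      if ∀ i ∈ D, i + 1 ∉ D then x ^ #D * (1 + x) ^ (k - 2 * #D) else 0 := by
  split_ifs with h
  · set A := D.image (· + 1)
    have hAk : A ⊆ Icc 1 k := by
      intro a ha
      obtain ⟨i, hi, rfl⟩ := mem_image.1 ha
      have := mem_Ico.1 (hD hi)
      exact mem_Icc.2 (by omega)
    have hDk : D ⊆ Icc 1 k := hD.trans Ico_subset_Icc_self
    have hAD : Disjoint A D := by
      rw [disjoint_left]
      intro a ha
      obtain ⟨i, hi, rfl⟩ := mem_image.1 ha
      exact h i hi
    have hcA : #A = #D := card_image_of_injective _ (add_left_injective 1)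
    have hcard : #(Icc 1 k \ (A ∪ D)) = k - 2 * #D := by
      rw [card_sdiff_of_subset (union_subset hAk hDk), card_union_of_disjoint hAD, hcA,
        Nat.card_Icc]
      omega
    rw [← hcard, add_comm, ← Finset.sum_pow_mul_eq_add_pow, Finset.mul_sum]
    symm
    refine Finset.sum_bij' (fun J _ => A ∪ J) (fun I _ => I \ A) ?_ ?_ ?_ ?_ ?_
    · intro J hJ
      rw [mem_powerset, subset_sdiff] at hJ
      refine mem_filter.2 ⟨mem_powerset.2 (union_subset hAk hJ.1), fun i hi => ⟨?_, ?_⟩⟩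
      · exact mem_union_left _ (mem_image_of_mem _ hi)
      · rw [mem_union, not_or]
        exact ⟨disjoint_right.1 hAD hi, fun hiJ => disjoint_left.1 hJ.2 hiJ (mem_union_right _ hi)⟩
    · intro I hI
      rw [mem_filter, mem_powerset] at hI
      rw [mem_powerset]
      intro a ha
      rw [mem_sdiff] at ha
      refine mem_sdiff.2 ⟨hI.1 ha.1, ?_⟩
      rw [mem_union, not_or]
      exact ⟨ha.2, fun haD => (hI.2 a haD).2 ha.1⟩
    · intro J hJ
      rw [mem_powerset, subset_sdiff, disjoint_union_right] at hJ
      exact union_sdiff_cancel_left hJ.2.1.symm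
    · intro I hI
      rw [mem_filter] at hI
      refine union_sdiff_of_subset ?_
      intro a ha
      obtain ⟨i, hi, rfl⟩ := mem_image.1 ha
      exact (hI.2 i hi).1
    · intro J hJ
      rw [mem_powerset, subset_sdiff, disjoint_union_right] at hJ
      rw [card_union_of_disjoint hJ.2.1.symm, hcA]
      simp [pow_add]
  · push Not at h
    obtain ⟨i, hi, hi'⟩ := h
    refine Finset.sum_eq_zero fun I hI => ?_
    rw [mem_filter] at hI
    exact absurd (hI.2 i hi).1 (hI.2 _ hi').2

/-- For `1 ≤ k ≤ n`, in `ℤ[x]`: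
`Σ_{I ⊆ {1,…,k}} binom(n, ΔI) x^{|I|}
  = Σ_{σ ∈ S_k, Des(σ) ∈ nc(k-1)} binom(n-σ(k), k-σ(k)) x^{des σ} (1+x)^{k-2·des σ}`. -/
theorem augChow_uniform_monomial_eq_gamma_binomial (n k : ℕ) (hk : 1 ≤ k) (hkn : k ≤ n) :
    ∑ I ∈ (Finset.Icc 1 k).powerset,
      (binomDelta n I : Polynomial ℤ) * X ^ I.card
    = ∑ σ ∈ (Finset.univ : Finset (Equiv.Perm (Fin k))).filter
        (fun σ => descSet k σ ⊆ Finset.Icc 1 (k - 1)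
          ∧ ∀ i ∈ descSet k σ, i + 1 ∉ descSet k σ),
      ((n - oneline k σ k).choose (k - oneline k σ k) : Polynomial ℤ)
        * X ^ (descSet k σ).card
        * (1 + X) ^ (k - 2 * (descSet k σ).card) := by
  set F : Finset ℕ → ℤ[X] := fun D =>
    ∑ I ∈ (Icc 1 k).powerset with ∀ i ∈ D, i + 1 ∈ I ∧ i ∉ I, X ^ #I with hF
  have hF0 (D : Finset ℕ) (i : ℕ) (hi : i ∈ D) (hki : k ≤ i) : F D = 0 := by
    refine Finset.sum_eq_zero fun I hI => ?_
    rw [mem_filter, mem_powerset] at hI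
    have := mem_Icc.1 (hI.1 (hI.2 i hi).1)
    omega
  calc
    _ = ∑ w : Equiv.Perm (Fin n), F (descSet n w) := by
      simp only [hF, Finset.sum_filter]
      rw [Finset.sum_comm]
      refine Finset.sum_congr rfl fun I hI => ?_
      rw [binomDelta_eq_sum ((mem_powerset.1 hI).trans (Icc_subset_Icc_right hkn)), Nat.cast_sum,
        Finset.sum_mul]
      refine Finset.sum_congr rfl fun w _ => ?_
      split_ifs <;> simp
    _ = _ := by
      rw [sum_descSet_eq_sum_choose hk hkn F hF0, Finset.sum_filter]
      refine Finset.sum_congr rfl fun σ _ => ?_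
      have hsub : descSet k σ ⊆ Icc 1 (k - 1) := fun i hi => by
        have := mem_Ico.1 (descSet_subset_Ico k σ hi)
        exact mem_Icc.2 (by omega)
      simp only [hF, sum_powerset_filter_blockMinima _ (descSet_subset_Ico k σ), hsub, true_and]
      split_ifs
      · rw [mul_assoc]
      · rw [mul_zero]
end

section
/- Let n ≥ 1, let I ⊆ [n] be nonempty, and let π ∈ S_n. The minimum cardinality of a set C ⊆ [n] such that [n]∖C contains no set J with |J| = |I| and I ≤_π J equals n + 1 − c, where c is the index with π(c) = max_π(I) and max_π(I) is the maximum of I with respect to ≤_π. In other words, the cogirth of the Schubert matroid S_{I,π} equals n + 1 − π^{−1}(max_π(I)). -/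
open Finset

/-- The total order `≤_π` on `{1,…,n}` determined by `π ∈ S_n`:
`π(1) ≤_π π(2) ≤_π … ≤_π π(n)`. -/
def piLE {n : ℕ} (π : Equiv.Perm (Fin n)) (a b : Fin n) : Prop :=
  π.symm a ≤ π.symm b

instance {n : ℕ} (π : Equiv.Perm (Fin n)) : DecidableRel (piLE π) :=
  fun a b => inferInstanceAs (Decidable (π.symm a ≤ π.symm b))

instance {n : ℕ} (π : Equiv.Perm (Fin n)) : IsTrans (Fin n) (piLE π) :=
  ⟨fun _ _ _ h₁ h₂ => le_trans h₁ h₂⟩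

instance {n : ℕ} (π : Equiv.Perm (Fin n)) : IsAntisymm (Fin n) (piLE π) :=
  ⟨fun _ _ h₁ h₂ => π.symm.injective (le_antisymm h₁ h₂)⟩

instance {n : ℕ} (π : Equiv.Perm (Fin n)) : IsTotal (Fin n) (piLE π) :=
  ⟨fun a b => le_total (π.symm a) (π.symm b)⟩

/-- The elements of `I`, listed increasingly with respect to `≤_π`. -/
def piSort {n : ℕ} (π : Equiv.Perm (Fin n)) (I : Finset (Fin n)) : List (Fin n) :=
  I.sort (piLE π)

/-- `I ≤_π J`: listing `I` and `J` increasingly with respect to `≤_π`, each element of `I`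
is `≤_π` the corresponding element of `J` (this forces `|I| = |J|`). -/
def piDom {n : ℕ} (π : Equiv.Perm (Fin n)) (I J : Finset (Fin n)) : Prop :=
  List.Forall₂ (piLE π) (piSort π I) (piSort π J)

instance {n : ℕ} (π : Equiv.Perm (Fin n)) (I J : Finset (Fin n)) :
    Decidable (piDom π I J) :=
  inferInstanceAs (Decidable (List.Forall₂ _ _ _))

/-- The set of bases `B_{I,π} = {J ⊆ [n] : |J| = |I|, I ≤_π J}` of the Schubert
matroid `S_{I,π}`. -/
def schubertBases {n : ℕ} (π : Equiv.Perm (Fin n)) (I : Finset (Fin n)) :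
    Finset (Finset (Fin n)) :=
  Finset.univ.filter fun J => J.card = I.card ∧ piDom π I J

theorem List.getElem_add_sub_le_of_pairwise_lt {l : List ℕ} (hl : l.Pairwise (· < ·))
    {i j : ℕ} (hij : i ≤ j) (hj : j < l.length) : l[i] + (j - i) ≤ l[j] := by
  induction j, hij using Nat.le_induction with
  | base => simp
  | succ j hij ih =>
    have h₁ := ih (by omega)
    have h₂ : l[j] < l[j + 1] := List.pairwise_iff_getElem.1 hl j (j + 1) (by omega) hj (by omega)
    omega

theorem List.Forall₂.exists_mem_right {α β : Type*} {R : α → β → Prop} {l₁ : List α}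
    {l₂ : List β} (h : List.Forall₂ R l₁ l₂) {a : α} (ha : a ∈ l₁) : ∃ b ∈ l₂, R a b := by
  induction h with
  | nil => simp at ha
  | cons hab _ ih =>
    rcases List.mem_cons.1 ha with rfl | ha
    · exact ⟨_, by simp, hab⟩
    · obtain ⟨b, hb, hr⟩ := ih ha
      exact ⟨b, by simp [hb], hr⟩

theorem piSort_map_pairwise_lt {n : ℕ} (π : Equiv.Perm (Fin n)) (I : Finset (Fin n)) :
    ((piSort π I).map fun x => (π.symm x : ℕ)).Pairwise (· < ·) := by
  rw [List.pairwise_map]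
  refine ((Finset.pairwise_sort I (piLE π)).and (Finset.sort_nodup I (piLE π))).imp ?_
  rintro a b ⟨h, hne⟩
  exact lt_of_le_of_ne h fun h' => hne (π.symm.injective (Fin.ext h'))

theorem card_filter_piLE {n : ℕ} (π : Equiv.Perm (Fin n)) (M : Fin n) :
    (Finset.univ.filter fun x => piLE π M x).card = n - (π.symm M : ℕ) := by
  rw [← Fin.card_Ici]
  exact Finset.card_equiv π.symm fun x => by
    simp only [Finset.mem_filter, Finset.mem_univ, true_and, Finset.mem_Ici]
    rfl

/-- A set with at least as many elements as there are elements `≤_π`-below the maximum of `I`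
contains a basis: its `|I|` largest elements. -/
theorem exists_mem_schubertBases_subset {n : ℕ} (π : Equiv.Perm (Fin n))
    {I D : Finset (Fin n)} {M : Fin n} (hM : M ∈ I) (hmax : ∀ i ∈ I, piLE π i M)
    (hD : (π.symm M : ℕ) < D.card) : ∃ J ∈ schubertBases π I, J ⊆ D := by
  have hIle (t : ℕ) (ht : t < (piSort π I).length) :
      (π.symm (piSort π I)[t] : ℕ) + (I.card - 1 - t) ≤ π.symm M := by
    have hlen : (piSort π I).length = I.card := Finset.length_sort _
    have h := List.getElem_add_sub_le_of_pairwise_lt (piSort_map_pairwise_lt π I)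
      (i := t) (j := I.card - 1) (by omega) (by simp only [List.length_map]; omega)
    simp only [List.getElem_map] at h
    have hlast : (π.symm ((piSort π I)[I.card - 1]'(by omega)) : ℕ) ≤ π.symm M :=
      hmax _ ((Finset.mem_sort (piLE π)).1 (List.getElem_mem _))
    omega
  have hDge (t : ℕ) (ht : t < (piSort π D).length) : t ≤ π.symm (piSort π D)[t] := by
    have h := List.getElem_add_sub_le_of_pairwise_lt (piSort_map_pairwise_lt π D)
      (i := 0) (j := t) (by omega) (by simpa using ht)
    simp only [List.getElem_map] at h
    omega
  have hIlen : (piSort π I).length = I.card := Finset.length_sort _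
  have hDlen : (piSort π D).length = D.card := Finset.length_sort _
  have hpos : 0 < I.card := Finset.card_pos.2 ⟨M, hM⟩
  have hcard : I.card ≤ D.card := by
    have := hIle 0 (by omega)
    omega
  set l := (piSort π D).drop (D.card - I.card) with hl
  have hsub : l.Sublist (piSort π D) := List.drop_sublist _ _
  have hnodup : l.Nodup := (Finset.sort_nodup D (piLE π)).sublist hsub
  have hllen : l.length = I.card := by rw [hl, List.length_drop]; omega
  have hsort : piSort π l.toFinset = l :=
    (List.toFinset_sort (piLE π) hnodup).2 ((Finset.pairwise_sort D (piLE π)).sublist hsub)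
  refine ⟨l.toFinset, ?_, fun x hx =>
    (Finset.mem_sort (piLE π)).1 (hsub.subset (List.mem_toFinset.1 hx))⟩
  simp only [schubertBases, Finset.mem_filter, Finset.mem_univ, true_and]
  refine ⟨by rw [List.toFinset_card_of_nodup hnodup, hllen], ?_⟩
  rw [piDom, hsort, List.forall₂_iff_get]
  refine ⟨by rw [hIlen, hllen], fun t h₁ h₂ => ?_⟩
  simp only [List.get_eq_getElem, hl, List.getElem_drop, piLE, Fin.le_def]
  have h₃ := hIle t h₁
  have h₄ := hDge (D.card - I.card + t) (by omega)
  omega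

/-- Let `I ⊆ [n]` be nonempty, `π ∈ S_n`, and let `M` be the `≤_π`-maximum
of `I`.  The minimum cardinality of a set `C ⊆ [n]` such that `[n] ∖ C` contains no `J` with
`|J| = |I|` and `I ≤_π J` equals `n + 1 - c`, where `c = π⁻¹(M)` (as an index in `{1,…,n}`);
i.e. the cogirth of the Schubert matroid `S_{I,π}` is `n + 1 - π⁻¹(max_π I)`. -/
theorem schubert_cogirth (n : ℕ) (hn : 1 ≤ n) (π : Equiv.Perm (Fin n))
    (I : Finset (Fin n)) (hI : I.Nonempty) (M : Fin n) (hM : M ∈ I)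
    (hmax : ∀ i ∈ I, piLE π i M) :
    IsLeast {c : ℕ | ∃ C : Finset (Fin n), C.card = c ∧
        ∀ J ∈ schubertBases π I, ¬ J ⊆ Cᶜ}
      (n + 1 - ((π.symm M : ℕ) + 1)) := by
  rw [Nat.add_sub_add_right]
  constructor
  · refine ⟨_, card_filter_piLE π M, fun J hJ hJC => ?_⟩
    simp only [schubertBases, Finset.mem_filter, Finset.mem_univ, true_and] at hJ
    obtain ⟨j, hj, hMj⟩ := hJ.2.exists_mem_right ((Finset.mem_sort (piLE π)).2 hM)
    have hjC := hJC ((Finset.mem_sort (piLE π)).1 hj)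
    simp [hMj] at hjC
  · rintro _ ⟨C, rfl, hC⟩
    by_contra! hlt
    obtain ⟨J, hJ, hJC⟩ := exists_mem_schubertBases_subset π (D := Cᶜ) hM hmax (by
      rw [Finset.card_compl, Fintype.card_fin]
      omega)
    exact hC J hJ hJC
end
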